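/- arXiv:math/0703766 — 2 statements merged into one kernel-verified Lean document; each statement's English description precedes it below -/
import Mathlib

section
/- (Hurewicz-type mapping theorem) Let f : X → Y be a large-scale uniform map between metric spaces, let m, n ∈ ℕ, and suppose asdim Y ≤ n. Suppose further that asdim f ≤ m, i.e., every subset A ⊆ X such that f(A) (with the restricted metric) has asdim f(A) ≤ 0 satisfies asdim A ≤ m. Then asdim X ≤ n + m. -/
/-- `𝒰` is `r`-disjoint: points of distinct members are at distance greater than `r`. -/
def RDisjoint {X : Type*} [MetricSpace X] (r : ℝ) (𝒰 : Set (Set X)) : Prop :=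
  ∀ U ∈ 𝒰, ∀ V ∈ 𝒰, U ≠ V → ∀ x ∈ U, ∀ y ∈ V, r < dist x y

/-- `U` has diameter at most `D`. -/
def DiamLE {X : Type*} [MetricSpace X] (D : ℝ) (U : Set X) : Prop :=
  ∀ x ∈ U, ∀ y ∈ U, dist x y ≤ D

/-- `X` has asymptotic dimension at most `n`: for every `r > 0` there exist `n + 1` families
of subsets of `X`, each `r`-disjoint, all uniformly bounded by a common bound `D`, whose
union covers `X`. -/
def AsdimLE (n : ℕ) (X : Type*) [MetricSpace X] : Prop :=
  ∀ r : ℝ, 0 < r → ∃ (𝒰 : Fin (n + 1) → Set (Set X)) (D : ℝ),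
    (∀ x : X, ∃ i, ∃ U ∈ 𝒰 i, x ∈ U) ∧
    (∀ i, RDisjoint r (𝒰 i)) ∧
    (∀ i, ∀ U ∈ 𝒰 i, DiamLE D U)

/-- `Z` is partitioned by the labels `p` into sets of diameter at most `D`, and coloured by `c` with
`k` colours so that distinct pieces of the same colour are `r`-disjoint. -/
def ColorLE {X : Type*} [MetricSpace X] (Z : Set X) (k : ℕ) (r D : ℝ) : Prop :=
  ∃ (c : X → ℕ) (p : X → Set X), (∀ x ∈ Z, c x < k) ∧
    (∀ x ∈ Z, ∀ y ∈ Z, c x = c y → dist x y ≤ r → p x = p y) ∧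
    (∀ x ∈ Z, ∀ y ∈ Z, p x = p y → dist x y ≤ D)

theorem ColorLE.of_label {X κ : Type*} [MetricSpace X] {Z : Set X} {k : ℕ} {r D : ℝ}
    (c : X → ℕ) (q : X → κ) (hc : ∀ x ∈ Z, c x < k)
    (hr : ∀ x ∈ Z, ∀ y ∈ Z, c x = c y → dist x y ≤ r → q x = q y)
    (hD : ∀ x ∈ Z, ∀ y ∈ Z, q x = q y → dist x y ≤ D) : ColorLE Z k r D := by
  refine ⟨c, fun x => {y | q y = q x}, hc, fun x hx y hy h1 h2 => ?_, fun x hx y hy h => ?_⟩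
  · simp only [hr x hx y hy h1 h2]
  · have h' : x ∈ {z | q z = q x} := rfl
    rw [show {z | q z = q x} = {z | q z = q y} from h] at h'
    exact hD x hx y hy h'

theorem ColorLE.mono {X : Type*} [MetricSpace X] {Z Z' : Set X} {k k' : ℕ} {r r' D D' : ℝ}
    (h : ColorLE Z k r D) (hZ : Z' ⊆ Z) (hk : k ≤ k') (hr : r' ≤ r) (hD : D ≤ D') :
    ColorLE Z' k' r' D' := by
  obtain ⟨c, p, h1, h2, h3⟩ := h
  exact ⟨c, p, fun x hx => (h1 x (hZ hx)).trans_le hk,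
    fun x hx y hy hc hd => h2 x (hZ hx) y (hZ hy) hc (hd.trans hr),
    fun x hx y hy hp => (h3 x (hZ hx) y (hZ hy) hp).trans hD⟩

theorem AsdimLE.colorLE_range {W X : Type*} [MetricSpace W] [MetricSpace X] {g : W → X}
    (hg : Isometry g) {m : ℕ} (h : AsdimLE m W) {r : ℝ} (hr : 0 < r) :
    ∃ D, ColorLE (Set.range g) (m + 1) r D := by
  obtain ⟨𝒰, D, hcov, hdis, hdiam⟩ := h r hr
  have key : ∀ x : X, ∃ (i : Fin (m + 1)) (U : Set W), ∀ w, g w = x → U ∈ 𝒰 i ∧ w ∈ U := by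
    intro x
    by_cases hx : ∃ w, g w = x
    · obtain ⟨w, rfl⟩ := hx
      obtain ⟨i, U, hU, hxU⟩ := hcov w
      exact ⟨i, U, fun w' hw => hg.injective hw ▸ ⟨hU, hxU⟩⟩
    · exact ⟨0, ∅, fun w hw => absurd ⟨w, hw⟩ hx⟩
  choose i U hU using key
  refine ⟨D, .of_label (fun x => (i x : ℕ)) U (fun x _ => (i x).2) ?_ ?_⟩
  · rintro _ ⟨v, rfl⟩ _ ⟨w, rfl⟩ hc hd
    by_contra hne
    have hc' : i (g v) = i (g w) := Fin.ext hc
    have := hdis _ _ (hU _ v rfl).1 _ (hc' ▸ (hU _ w rfl).1) hne v (hU _ v rfl).2 w (hU _ w rfl).2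
    rw [hg.dist_eq] at hd
    exact absurd hd (not_le.2 this)
  · rintro _ ⟨v, rfl⟩ _ ⟨w, rfl⟩ hp
    rw [hg.dist_eq]
    exact hdiam _ _ (hU _ v rfl).1 v (hU _ v rfl).2 w (hp ▸ (hU _ w rfl).2)

theorem AsdimLE.colorLE {X : Type*} [MetricSpace X] {A : Set X} {m : ℕ} (h : AsdimLE m A)
    {r : ℝ} (hr : 0 < r) : ∃ D, ColorLE A (m + 1) r D := by
  simpa using h.colorLE_range isometry_subtype_coe hr

theorem asdimLE_of_colorLE {X : Type*} [MetricSpace X] {m : ℕ}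
    (h : ∀ r : ℝ, 0 < r → ∃ D, ColorLE (Set.univ : Set X) (m + 1) r D) : AsdimLE m X := by
  intro r hr
  obtain ⟨D, c, p, hc, hp, hD⟩ := h r hr
  refine ⟨fun i => {U | ∃ x, c x = i ∧ U = {y | c y = i ∧ p y = p x}}, D, ?_, ?_, ?_⟩
  · intro x
    exact ⟨⟨c x, hc x trivial⟩, _, ⟨x, rfl, rfl⟩, rfl, rfl⟩
  · rintro i U ⟨u, hu, rfl⟩ V ⟨v, hv, rfl⟩ hne x ⟨hxc, hxp⟩ y ⟨hyc, hyp⟩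
    by_contra hd
    apply hne
    have := hp x trivial y trivial (hxc.trans hyc.symm) (not_lt.1 hd)
    rw [← hxp, ← hyp, this]
  · rintro i U ⟨u, hu, rfl⟩ x ⟨hxc, hxp⟩ y ⟨hyc, hyp⟩
    exact hD x trivial y trivial (hxp.trans hyp.symm)

/-- A partition into bounded pieces such that every `r`-ball meets at most `k` pieces can be
turned into a partition coloured with `k` colours, at the cost of shrinking the scale to `r / k`. -/
theorem ColorLE.of_multiplicity {X κ : Type*} [MetricSpace X] {Z : Set X} {k : ℕ} {r D : ℝ}
    (hr : 0 < r) (hk : 0 < k) (q : X → κ)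
    (hD : ∀ x ∈ Z, ∀ y ∈ Z, q x = q y → dist x y ≤ D)
    (hm : ∀ x ∈ Z, ∃ code : X → ℕ, (∀ y ∈ Z, dist x y ≤ r → code y < k) ∧
      ∀ y ∈ Z, ∀ y' ∈ Z, dist x y ≤ r → dist x y' ≤ r → code y = code y' → q y = q y') :
    ColorLE Z k (r / k) (2 * r + D) := by
  classical
  have hk' : (0 : ℝ) < k := by exact_mod_cast hk
  set N : X → ℝ → Set κ := fun x t => {v | ∃ y ∈ Z, dist x y ≤ t ∧ q y = v} with hN
  have hmono : ∀ x s t, s ≤ t → N x s ⊆ N x t := by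
    rintro x s t hst v ⟨y, hy, hd, rfl⟩
    exact ⟨y, hy, hd.trans hst, rfl⟩
  have hfin : ∀ x ∈ Z, (N x r).Finite ∧ (N x r).ncard ≤ k := by
    intro x hx
    obtain ⟨code, h1, h2⟩ := hm x hx
    let g : ℕ → κ := fun n => if h : ∃ y ∈ Z, dist x y ≤ r ∧ code y = n then q h.choose else q x
    have hsub : N x r ⊆ g '' (Finset.range k : Set ℕ) := by
      rintro v ⟨y, hy, hd, rfl⟩
      refine ⟨code y, by simpa using h1 y hy hd, ?_⟩
      have h : ∃ z ∈ Z, dist x z ≤ r ∧ code z = code y := ⟨y, hy, hd, rfl⟩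
      simp only [g, dif_pos h]
      exact h2 _ h.choose_spec.1 y hy h.choose_spec.2.1 hd h.choose_spec.2.2
    have hf : (g '' (Finset.range k : Set ℕ)).Finite := (Finset.finite_toSet _).image _
    refine ⟨hf.subset hsub, (Set.ncard_le_ncard hsub hf).trans ?_⟩
    refine (Set.ncard_image_le (Finset.finite_toSet _)).trans ?_
    simp
  have hself : ∀ x ∈ Z, ∀ t, 0 ≤ t → q x ∈ N x t := fun x hx t ht => ⟨x, hx, by simpa, rfl⟩
  set t : ℕ → ℝ := fun i => i * (r / k) with ht
  have ht0 : ∀ i, 0 ≤ t i := fun i => by positivity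
  have htr : ∀ i ≤ k, t i ≤ r := by
    intro i hi
    have : (i : ℝ) ≤ k := by exact_mod_cast hi
    calc t i ≤ k * (r / k) := by simp only [ht]; gcongr
      _ = r := by field_simp
  have htm : Monotone t := fun i j hij => by
    simp only [ht]; gcongr
  have hstab : ∀ x, ∃ i, x ∈ Z → i < k ∧ N x (t (i + 1)) ⊆ N x (t i) := by
    intro x
    by_cases hx : x ∈ Z
    swap
    · exact ⟨0, fun h => absurd h hx⟩
    by_contra hcon
    push Not at hcon
    have hgrow : ∀ i ≤ k, i + 1 ≤ (N x (t i)).ncard := by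
      intro i
      induction i with
      | zero =>
        intro hi
        have hf := (hfin x hx).1.subset (hmono x _ _ (htr 0 hi))
        exact (Set.ncard_pos hf).2 ⟨_, hself x hx _ (ht0 0)⟩
      | succ i ih =>
        intro hi
        have hf := (hfin x hx).1.subset (hmono x _ _ (htr (i + 1) hi))
        have := Set.ncard_lt_ncard (s := N x (t i)) (t := N x (t (i + 1)))
          ⟨hmono x _ _ (htm (Nat.le_succ i)), (hcon i).2 (by omega)⟩ hf
        have := ih (by omega)
        omega
    have h1 := hgrow k le_rfl
    have h2 := Set.ncard_le_ncard (hmono x _ _ (htr k le_rfl)) (hfin x hx).1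
    have h3 := (hfin x hx).2
    omega
  choose i hi using hstab
  have hfi : ∀ x ∈ Z, (N x (t (i x))).Finite := fun x hx =>
    (hfin x hx).1.subset (hmono x _ _ (htr _ (hi x hx).1.le))
  have hle : ∀ x ∈ Z, ∀ y ∈ Z, dist x y ≤ r / k → i x ≤ i y → N x (t (i x)) ⊆ N y (t (i y)) := by
    rintro x hx y hy hd hxy v ⟨z, hz, hxz, rfl⟩
    apply (hi y hy).2
    apply hmono y _ _ (htm (Nat.succ_le_succ hxy))
    refine ⟨z, hz, ?_, rfl⟩
    have : t (i x + 1) = t (i x) + r / k := by simp only [ht]; push_cast; ring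
    rw [Nat.succ_eq_add_one, this]
    linarith [dist_triangle y x z, dist_comm x y]
  refine .of_label (fun x => (N x (t (i x))).ncard - 1) (fun x => N x (t (i x))) ?_ ?_ ?_
  · intro x hx
    have h2 := Set.ncard_le_ncard (hmono x _ _ (htr _ (hi x hx).1.le)) (hfin x hx).1
    have h3 := (hfin x hx).2
    show _ - 1 < k
    omega
  · intro x hx y hy hc hd
    have hpos : ∀ z ∈ Z, 0 < (N z (t (i z))).ncard := fun z hz =>
      (Set.ncard_pos (hfi z hz)).2 ⟨_, hself z hz _ (ht0 _)⟩
    have hx1 := hpos x hx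
    have hy1 := hpos y hy
    have hc' : (N x (t (i x))).ncard = (N y (t (i y))).ncard := by
      omega
    rcases le_total (i x) (i y) with h | h
    · exact Set.eq_of_subset_of_ncard_le (hle x hx y hy hd h) hc'.ge (hfi y hy)
    · exact (Set.eq_of_subset_of_ncard_le (hle y hy x hx (by rwa [dist_comm]) h) hc'.le
        (hfi x hx)).symm
  · intro x hx y hy hp
    have h := hself x hx _ (ht0 (i x))
    obtain ⟨z, hz, hyz, hq⟩ : q x ∈ N y (t (i y)) := hp ▸ h
    have := hD z hz x hx hq
    have := htr _ (hi y hy).1.le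
    linarith [dist_triangle x z y, dist_comm x z, dist_comm y z]

/-- If `f` has asymptotic dimension at most `m` in the sense of the Hurewicz theorem, then sets
with uniformly bounded images admit uniformly bounded coloured partitions. -/
theorem exists_uniform_colorLE {X Y : Type*} [MetricSpace X] [MetricSpace Y] {f : X → Y} {m : ℕ}
    (hdimf : ∀ A : Set X, AsdimLE 0 ↥(f '' A) → AsdimLE m ↥A) {r : ℝ} (hr : 0 < r) (R : ℝ) :
    ∃ D, ∀ A : Set X, (∀ x ∈ A, ∀ y ∈ A, dist (f x) (f y) ≤ R) → ColorLE A (m + 1) r D := by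
  by_contra hcon
  push Not at hcon
  obtain ⟨A₀, -, hA₀⟩ := hcon 0
  have hne₀ : A₀.Nonempty := by
    rw [Set.nonempty_iff_ne_empty]
    rintro rfl
    exact hA₀ ⟨fun _ => 0, fun _ => ∅, by simp, by simp, by simp⟩
  obtain ⟨x₀, -⟩ := hne₀
  have hfar : ∀ s : ℝ, ∃ (A : Set X) (T : ℝ), s ≤ T ∧ (∀ x ∈ A, ∀ y ∈ A, dist (f x) (f y) ≤ R) ∧
      ¬ ColorLE A (m + 1) r s ∧ (∀ x ∈ A, s ≤ dist (f x₀) (f x) ∧ dist (f x₀) (f x) ≤ T) := by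
    intro s
    have h0 : AsdimLE 0 ↥(f '' {x | dist (f x₀) (f x) ≤ s + R}) := by
      refine asdimLE_of_colorLE fun r' _ => ⟨2 * (s + R), fun _ => 0, fun _ => ∅, by simp, by simp, ?_⟩
      rintro ⟨_, x, hx, rfl⟩ - ⟨_, y, hy, rfl⟩ - -
      have hx : dist (f x₀) (f x) ≤ s + R := hx
      have hy : dist (f x₀) (f y) ≤ s + R := hy
      rw [Subtype.dist_eq]
      linarith [dist_triangle (f x) (f x₀) (f y), dist_comm (f x) (f x₀)]
    obtain ⟨D, hD⟩ := (hdimf _ h0).colorLE hr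
    obtain ⟨A, hA, hbad⟩ := hcon (max D s)
    have hns : ¬ A ⊆ {x | dist (f x₀) (f x) ≤ s + R} := fun hsub =>
      hbad (hD.mono hsub le_rfl le_rfl (le_max_left _ _))
    obtain ⟨a, ha, ha'⟩ := Set.not_subset.1 hns
    have ha' : s + R < dist (f x₀) (f a) := not_le.1 ha'
    have hR : 0 ≤ R := dist_nonneg.trans (hA a ha a ha)
    refine ⟨A, dist (f x₀) (f a) + R, by linarith, hA,
      fun h => hbad (h.mono subset_rfl le_rfl le_rfl (le_max_right _ _)), fun x hx => ⟨?_, ?_⟩⟩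
    · linarith [dist_triangle (f x₀) (f x) (f a), hA x hx a ha]
    · linarith [dist_triangle (f x₀) (f a) (f x), hA a ha x hx]
  choose A T hsT hAR hbad hAT using hfar
  let s : ℕ → ℝ := fun n => Nat.rec 0 (fun n s => T s + (n + 1)) n
  have hs : ∀ n, s (n + 1) = T (s n) + (n + 1) := fun n => rfl
  have hsm : Monotone s := monotone_nat_of_le_succ fun n => by
    rw [hs]; linarith [hsT (s n), (Nat.cast_nonneg n : (0 : ℝ) ≤ n)]
  have hTs : ∀ i j, i < j → T (s i) + j ≤ s j := by
    intro i j hij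
    obtain ⟨j, rfl⟩ : ∃ j', j = j' + 1 := ⟨j - 1, by omega⟩
    have h : T (s i) ≤ T (s j) := by
      rcases eq_or_lt_of_le (Nat.le_of_lt_succ hij) with rfl | h
      · rfl
      · have := hsm (Nat.succ_le_of_lt h)
        rw [Nat.succ_eq_add_one, hs] at this
        linarith [hsT (s j), (Nat.cast_nonneg i : (0 : ℝ) ≤ i)]
    rw [hs]
    push_cast
    linarith
  have hsn : ∀ n : ℕ, (n : ℝ) ≤ s n := by
    intro n
    rcases n.eq_zero_or_pos with rfl | hn
    · simp [s]
    · have := hTs 0 n hn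
      have := hsT (s 0)
      have : s 0 = 0 := rfl
      linarith
  have hzero : AsdimLE 0 ↥(f '' ⋃ n, A (s n)) := by
    refine asdimLE_of_colorLE fun r' _ => ?_
    have hidx : ∀ y : ↥(f '' ⋃ n, A (s n)), ∃ n, ∃ x ∈ A (s n), f x = y := by
      rintro ⟨_, x, hx, rfl⟩
      obtain ⟨n, hn⟩ := Set.mem_iUnion.1 hx
      exact ⟨n, x, hn, rfl⟩
    choose idx x hx hfx using hidx
    set n₀ := ⌈r'⌉₊
    have hclose : ∀ y y', idx y < idx y' → dist y y' ≤ r' → idx y' ≤ n₀ := by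
      intro y y' hlt hd
      rw [Subtype.dist_eq, ← hfx y, ← hfx y'] at hd
      have h1 := (hAT _ _ (hx y)).2
      have h2 := (hAT _ _ (hx y')).1
      have h3 := hTs _ _ hlt
      have : (idx y' : ℝ) ≤ r' := by
        linarith [dist_triangle (f x₀) (f (x y)) (f (x y'))]
      exact_mod_cast this.trans (Nat.le_ceil r')
    refine ⟨max R (2 * s (n₀ + 1)), .of_label (fun _ => 0) (fun y => max (idx y) n₀) (by simp) ?_ ?_⟩
    · intro y _ y' _ _ hd
      rcases lt_trichotomy (idx y) (idx y') with h | h | h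
      · have := hclose y y' h hd
        omega
      · simp only [h]
      · have := hclose y' y h (by rwa [dist_comm])
        omega
    · intro y _ y' _ heq
      rw [Subtype.dist_eq, ← hfx y, ← hfx y']
      by_cases h : idx y ≤ n₀
      · have h' : idx y' ≤ n₀ := by omega
        refine le_trans ?_ (le_max_right _ _)
        have h1 := (hAT _ _ (hx y)).2
        have h2 := (hAT _ _ (hx y')).2
        have h3 := hTs _ _ (Nat.lt_succ_of_le h)
        have h4 := hTs _ _ (Nat.lt_succ_of_le h')
        rw [Nat.succ_eq_add_one] at h3 h4
        have h5 : (0 : ℝ) ≤ ((n₀ + 1 : ℕ) : ℝ) := Nat.cast_nonneg _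
        linarith [dist_triangle (f (x y)) (f x₀) (f (x y')), dist_comm (f (x y)) (f x₀)]
      · have h' : idx y = idx y' := by omega
        exact (hAR _ _ (hx y) _ (h' ▸ hx y')).trans (le_max_left _ _)
  obtain ⟨D, hD⟩ := (hdimf _ hzero).colorLE hr
  obtain ⟨n, hn⟩ := exists_nat_ge D
  exact hbad (s n) (hD.mono (Set.subset_iUnion (fun n => A (s n)) n) le_rfl le_rfl
    (hn.trans (hsn n)))

/-- Gluing: a set `Z` coloured with `k ≥ m + 1` colours, together with the preimage of a union `S`
of bounded pieces far apart from each other, can be coloured with `k + 1` colours. -/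
theorem ColorLE.union_preimage {X Y : Type*} [MetricSpace X] [MetricSpace Y] {f : X → Y} {m : ℕ}
    (hdimf : ∀ A : Set X, AsdimLE 0 ↥(f '' A) → AsdimLE m ↥A) {Z : Set X} {S : Set Y} {k : ℕ}
    {r D T R : ℝ} (hk : m + 1 ≤ k) (hr : 0 < r) (hZ : ColorLE Z k (2 * r) D) (hS : S.Nonempty)
    (hT : 0 < T) (hfT : ∀ x x', dist x x' ≤ r → dist (f x) (f x') ≤ T) (b : Y → Set Y)
    (hb : ∀ y ∈ S, ∀ y' ∈ S, dist y y' ≤ (6 * k + 8) * T → b y = b y')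
    (hbR : ∀ y ∈ S, ∀ y' ∈ S, b y = b y' → dist y y' ≤ R) :
    ∃ D', ColorLE (Z ∪ f ⁻¹' S) (k + 1) (r / (k + 1 : ℕ)) D' := by
  classical
  obtain ⟨c, p, hc, hp, hpD⟩ := hZ
  rcases isEmpty_or_nonempty X with hX | hX
  · exact ⟨0, c, p, fun x => hX.elim x, fun x => hX.elim x, fun x => hX.elim x⟩
  set M : ℝ := (3 * k + 3) * T with hM
  have hM0 : 0 < M := by positivity
  have hnear : ∀ x, ∃ s ∈ S, Metric.infDist (f x) S < M → dist (f x) s < M := by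
    intro x
    by_cases h : Metric.infDist (f x) S < M
    · obtain ⟨s, hs, hd⟩ := (Metric.infDist_lt_iff hS).1 h
      exact ⟨s, hs, fun _ => hd⟩
    · obtain ⟨s, hs⟩ := hS
      exact ⟨s, hs, fun h' => absurd h' h⟩
  choose s hsS hs using hnear
  set h : X → ℝ := fun x => Metric.infDist (f x) S with hh
  have hhT : ∀ x y, dist x y ≤ r → h y ≤ h x + T := by
    intro x y hd
    have h1 : h y ≤ h x + dist (f y) (f x) := Metric.infDist_le_infDist_add_dist
    have h2 := hfT y x (by rwa [dist_comm])
    linarith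
  set β : X → Set Y := fun x => b (s x) with hβ
  have hβeq : ∀ x y y', dist x y ≤ r → dist x y' ≤ r → h y < M → h y' < M → β y = β y' := by
    intro x y y' hy hy' hyM hyM'
    refine hb _ (hsS y) _ (hsS y') ?_
    have h1 := hs y hyM
    have h2 := hs y' hyM'
    have h3 := hfT x y hy
    have h4 := hfT x y' hy'
    have h5 := dist_triangle4 (s y) (f y) (f y') (s y')
    have h6 := dist_triangle (f y) (f x) (f y')
    rw [dist_comm (s y) (f y)] at h5
    rw [dist_comm (f y) (f x)] at h6
    have : (6 * k + 8) * T = 2 * M + 2 * T := by rw [hM]; ring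
    linarith
  obtain ⟨E, hE⟩ := exists_uniform_colorLE hdimf (r := 2 * r + 2 * |D|) (by positivity) (R + 2 * M)
  have hG : ∀ B : Set Y, ColorLE {x | h x < M ∧ β x = B} (m + 1) (2 * r + 2 * |D|) E := by
    intro B
    apply hE
    rintro x ⟨hx, hxB⟩ y ⟨hy, hyB⟩
    have h1 := hs x hx
    have h2 := hs y hy
    have h3 := hbR _ (hsS x) _ (hsS y) (hxB.trans hyB.symm)
    have h5 := dist_triangle4 (f x) (s x) (s y) (f y)
    rw [dist_comm (s y) (f y)] at h5
    linarith
  choose cB pB hcB hpB hpBE using hG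
  have hrep : ∀ (B : Set Y) (U : Set X), ∃ e : X, (∃ u ∈ Z, h u < M ∧ β u = B ∧ p u = U) →
      e ∈ Z ∧ h e < M ∧ β e = B ∧ p e = U := by
    intro B U
    by_cases hex : ∃ u ∈ Z, h u < M ∧ β u = B ∧ p u = U
    · obtain ⟨u, hu⟩ := hex
      exact ⟨u, fun _ => hu⟩
    · exact ⟨Classical.arbitrary X, fun h' => absurd h' hex⟩
  choose e he using hrep
  set rep : X → X := fun x => if x ∈ Z then e (β x) (p x) else x with hrepdef
  have hrep : ∀ x, h x < M → h (rep x) < M ∧ β (rep x) = β x ∧ dist x (rep x) ≤ |D| := by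
    intro x hx
    by_cases hxZ : x ∈ Z
    · simp only [hrepdef, if_pos hxZ]
      obtain ⟨h1, h2, h3, h4⟩ := he (β x) (p x) ⟨x, hxZ, hx, rfl, rfl⟩
      exact ⟨h2, h3, (hpD x hxZ _ h1 h4.symm).trans (le_abs_self D)⟩
    · simp only [hrepdef, if_neg hxZ]
      exact ⟨hx, trivial, by simp⟩
  set a : ℕ → ℝ := fun i => (3 * i + 3) * T with ha
  have haM : ∀ i < k, a i ≤ M := by
    intro i hi
    have : (i : ℝ) ≤ k := by exact_mod_cast hi.le
    simp only [ha, hM]; gcongr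
  have hout : ∀ x ∈ Z ∪ f ⁻¹' S, x ∉ Z → h x = 0 := by
    rintro x (hx | hx) hxZ
    · exact absurd hx hxZ
    · exact Metric.infDist_zero_of_mem hx
  set keep : X → Prop := fun x => x ∈ Z ∧ a (c x) ≤ h x with hkeep
  have hlow : ∀ x ∈ Z ∪ f ⁻¹' S, ¬ keep x → h x < M := by
    intro x hx hnk
    by_cases hxZ : x ∈ Z
    · exact (not_le.1 fun h' => hnk ⟨hxZ, h'⟩).trans_le (haM _ (hc x hxZ))
    · rw [hout x hx hxZ]; exact hM0
  set w : X → Set Y × Set X := fun x => (β x, pB (β x) (rep x)) with hw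
  set q : X → Set X ⊕ (Set Y × Set X) := fun x =>
    if keep x then Sum.inl (p x) else Sum.inr (w x) with hq
  refine ⟨_, .of_multiplicity (D := |D| + (2 * |D| + |E|)) hr (Nat.succ_pos k) q ?_ ?_⟩
  · intro x hx y hy hxy
    have hD0 := abs_nonneg D
    have hE0 := abs_nonneg E
    by_cases hkx : keep x <;> by_cases hky : keep y <;>
      simp only [hq, hkx, hky, if_true, if_false, Sum.inl.injEq, Sum.inr.injEq, reduceCtorEq] at hxy
    · linarith [hpD x hkx.1 y hky.1 hxy, le_abs_self D]
    · obtain ⟨h1, h2, h3⟩ := hrep x (hlow x hx hkx)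
      obtain ⟨h4, h5, h6⟩ := hrep y (hlow y hy hky)
      obtain ⟨hβ', hpp⟩ := Prod.mk.inj hxy
      rw [← hβ'] at h5 hpp
      have := hpBE (β x) (rep x) ⟨h1, h2⟩ (rep y) ⟨h4, h5⟩ hpp
      have h7 := dist_triangle4 x (rep x) (rep y) y
      rw [dist_comm (rep y) y] at h7
      linarith [le_abs_self E]
  · intro x hx
    by_cases hx2 : h x < 2 * T
    · have hball : ∀ y ∈ Z ∪ f ⁻¹' S, dist x y ≤ r → ¬ keep y := by
        rintro y hy hd ⟨hyZ, hya⟩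
        have h1 := hhT x y hd
        have h2 : 3 * T ≤ a (c y) := by simp only [ha]; nlinarith [(Nat.cast_nonneg (c y) : (0:ℝ) ≤ c y)]
        linarith
      refine ⟨fun y => cB (β y) (rep y), ?_, ?_⟩
      · intro y hy hd
        obtain ⟨h1, h2, -⟩ := hrep y (hlow y hy (hball y hy hd))
        have := hcB (β y) (rep y) ⟨h1, h2⟩
        show cB (β y) (rep y) < _
        omega
      · intro y hy y' hy' hd hd' hcc
        have hn := hball y hy hd
        have hn' := hball y' hy' hd'
        obtain ⟨h1, h2, h3⟩ := hrep y (hlow y hy hn)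
        obtain ⟨h4, h5, h6⟩ := hrep y' (hlow y' hy' hn')
        have hβ' := hβeq x y y' hd hd' (hlow y hy hn) (hlow y' hy' hn')
        simp only at hcc
        simp only [hq, if_neg hn, if_neg hn', hw]
        rw [← hβ'] at h5 hcc ⊢
        rw [hpB (β y) (rep y) ⟨h1, h2⟩ (rep y') ⟨h4, h5⟩ hcc ?_]
        have h7 := dist_triangle4 (rep y) y y' (rep y')
        have h8 := dist_triangle y x y'
        rw [dist_comm (rep y) y] at h7
        rw [dist_comm y x] at h8
        linarith
    · have hball : ∀ y ∈ Z ∪ f ⁻¹' S, dist x y ≤ r → y ∈ Z := by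
        intro y hy hd
        by_contra hyZ
        have h1 := hhT y x (by rwa [dist_comm])
        rw [hout y hy hyZ] at h1
        linarith
      have hpeq : ∀ y ∈ Z, ∀ y' ∈ Z, dist x y ≤ r → dist x y' ≤ r → c y = c y' → p y = p y' := by
        intro y hy y' hy' hd hd' hcc
        refine hp y hy y' hy' hcc ?_
        linarith [dist_triangle y x y', dist_comm x y]
      have hgap : ∀ i j : ℕ, |a i - h x| ≤ T → |a j - h x| ≤ T → i = j := by
        have aux : ∀ i j : ℕ, |a i - h x| ≤ T → |a j - h x| ≤ T → ¬ i < j := by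
          intro i j hi hj hij
          have h1 := (abs_le.1 hi).1
          have h2 := (abs_le.1 hj).2
          have h3 : (i : ℝ) + 1 ≤ j := by exact_mod_cast hij
          simp only [ha] at h1 h2
          nlinarith
        intro i j hi hj
        have := aux i j hi hj
        have := aux j i hj hi
        omega
      have hqeq : ∀ y ∈ Z, ∀ y' ∈ Z, dist x y ≤ r → dist x y' ≤ r → c y = c y' →
          (keep y ↔ keep y') → q y = q y' := by
        intro y hy y' hy' hd hd' hcc hiff
        have hpp := hpeq y hy y' hy' hd hd' hcc
        by_cases hky : keep y
        · simp only [hq, if_pos hky, if_pos (hiff.1 hky), hpp]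
        · have hky' := fun h' => hky (hiff.2 h')
          have hβ' := hβeq x y y' hd hd' (hlow y (.inl hy) hky) (hlow y' (.inl hy') hky')
          simp only [hq, if_neg hky, if_neg hky', hw, hrepdef, if_pos hy, if_pos hy', hpp, hβ']
      have hcross : ∀ y y', dist x y ≤ r → dist x y' ≤ r → y' ∈ Z → c y = c y' → keep y →
          ¬ keep y' → |a (c y) - h x| ≤ T := by
        intro y y' hd hd' hy' hcc hky hky'
        have h1 : h y' < a (c y') := not_le.1 fun h' => hky' ⟨hy', h'⟩
        rw [← hcc] at h1
        have h2 := hky.2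
        have h3 := hhT x y hd
        have h4 := hhT y' x (by rwa [dist_comm])
        rw [abs_le]
        constructor <;> linarith
      refine ⟨fun y => if keep y ∧ |a (c y) - h x| ≤ T then k else c y, ?_, ?_⟩
      · intro y hy hd
        have := hc y (hball y hy hd)
        dsimp only
        split_ifs <;> omega
      · intro y hy y' hy' hd hd' hcc
        have hyZ := hball y hy hd
        have hyZ' := hball y' hy' hd'
        have hck := hc y hyZ
        have hck' := hc y' hyZ'
        by_cases h1 : keep y ∧ |a (c y) - h x| ≤ T <;>
          by_cases h2 : keep y' ∧ |a (c y') - h x| ≤ T <;>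
          simp only [h1, h2, if_true, if_false, and_self] at hcc
        · exact hqeq y hyZ y' hyZ' hd hd' (hgap _ _ h1.2 h2.2) (iff_of_true h1.1 h2.1)
        · omega
        · omega
        · refine hqeq y hyZ y' hyZ' hd hd' hcc ⟨fun hky => ?_, fun hky => ?_⟩
          · by_contra hky'
            exact h1 ⟨hky, hcross y y' hd hd' hyZ' hcc hky hky'⟩
          · by_contra hky'
            exact h2 ⟨hky, hcross y' y hd' hd hyZ hcc.symm hky hky'⟩

/-- The preimage of the first `j + 1` colours of a coloured partition of the target, at a
sufficiently large scale, can be coloured with `m + 1 + j` colours. -/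
theorem exists_colorLE_preimage {X Y : Type*} [MetricSpace X] [MetricSpace Y] {f : X → Y} {m : ℕ}
    (hf : ∃ ρ : ℝ → ℝ, Monotone ρ ∧ ∀ x x' : X, dist (f x) (f x') ≤ ρ (dist x x'))
    (hdimf : ∀ A : Set X, AsdimLE 0 ↥(f '' A) → AsdimLE m ↥A) (j : ℕ) {r : ℝ} (hr : 0 < r) :
    ∃ L : ℝ, ∀ (c : Y → ℕ) (b : Y → Set Y) (R : ℝ),
      (∀ y y', c y = c y' → dist y y' ≤ L → b y = b y') →
      (∀ y y', b y = b y' → dist y y' ≤ R) →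
      ∃ D, ColorLE {x | c (f x) ≤ j} (m + 1 + j) r D := by
  obtain ⟨ρ, hρ, hfρ⟩ := hf
  induction j generalizing r with
  | zero =>
    refine ⟨ρ r, fun c b R hb hbR => ?_⟩
    obtain ⟨D, hD⟩ := exists_uniform_colorLE hdimf hr R
    have hG : ∀ B : Set Y, ColorLE {x | b (f x) = B} (m + 1) r D := fun B =>
      hD _ fun x hx y hy => hbR _ _ (Eq.trans hx (Eq.symm hy))
    choose cB pB h1 h2 h3 using hG
    refine ⟨D, .of_label (fun x => cB (b (f x)) x) (fun x => (b (f x), pB (b (f x)) x))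
      (fun x _ => h1 _ x rfl) ?_ ?_⟩
    · intro x hx y hy hc hd
      have hx : c (f x) ≤ 0 := hx
      have hy : c (f y) ≤ 0 := hy
      have hbb := hb (f x) (f y) (by omega) ((hfρ x y).trans (hρ hd))
      simp only [← hbb] at hc ⊢
      rw [h2 _ x rfl y hbb.symm hc hd]
    · intro x hx y hy hxy
      obtain ⟨hbb, hpp⟩ := Prod.mk.inj hxy
      rw [← hbb] at hpp
      exact h3 _ x rfl y hbb.symm hpp
  | succ j ih =>
    set k := m + 1 + j with hk
    have hk0 : (0 : ℝ) < ((k + 1 : ℕ) : ℝ) := by positivity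
    have hr1 : 0 < r * (k + 1 : ℕ) := by positivity
    obtain ⟨L, hL⟩ := ih (r := 2 * (r * (k + 1 : ℕ))) (by positivity)
    set T := max (ρ (r * (k + 1 : ℕ))) 1 with hT
    have hdiv : r * (k + 1 : ℕ) / (k + 1 : ℕ) = r := by field_simp
    refine ⟨max L ((6 * k + 8) * T), fun c b R hb hbR => ?_⟩
    obtain ⟨D, hD⟩ := hL c b R (fun y y' h1 h2 => hb y y' h1 (h2.trans (le_max_left _ _))) hbR
    have hset : {x | c (f x) ≤ j + 1} = {x | c (f x) ≤ j} ∪ f ⁻¹' {y | c y = j + 1} := by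
      ext x
      simp only [Set.mem_ofPred_eq, Set.mem_union, Set.mem_preimage]
      omega
    rw [hset]
    rcases Set.eq_empty_or_nonempty {y | c y = j + 1} with hS | hS
    · rw [hS, Set.preimage_empty, Set.union_empty]
      refine ⟨D, hD.mono subset_rfl (by omega) ?_ le_rfl⟩
      have : (1 : ℝ) ≤ ((k + 1 : ℕ) : ℝ) := by exact_mod_cast Nat.succ_pos k
      nlinarith
    · have := ColorLE.union_preimage hdimf (T := T) (R := R) (by omega : m + 1 ≤ k) hr1 hD hS
        (lt_of_lt_of_le one_pos (le_max_right _ _))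
        (fun x x' hd => ((hfρ x x').trans (hρ hd)).trans (le_max_left _ _)) b
        (fun y hy y' hy' hd => hb y y' (Eq.trans hy (Eq.symm hy')) (hd.trans (le_max_right _ _)))
        (fun y _ y' _ => hbR y y')
      rwa [hdiv] at this

/-- Hurewicz-type mapping theorem: if `f : X → Y` is large-scale uniform, `asdim Y ≤ n`, and
every subset `A ⊆ X` whose image has asymptotic dimension `0` satisfies `asdim A ≤ m`
(i.e. `asdim f ≤ m`), then `asdim X ≤ n + m`. -/
theorem asdim_hurewicz {X Y : Type*} [MetricSpace X] [MetricSpace Y] (f : X → Y) (m n : ℕ)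
    (hf : ∃ ρ : ℝ → ℝ, Monotone ρ ∧ ∀ x x' : X, dist (f x) (f x') ≤ ρ (dist x x'))
    (hY : AsdimLE n Y)
    (hdimf : ∀ A : Set X, AsdimLE 0 ↥(f '' A) → AsdimLE m ↥A) :
    AsdimLE (n + m) X := by
  refine asdimLE_of_colorLE fun r hr => ?_
  obtain ⟨L, hL⟩ := exists_colorLE_preimage hf hdimf n hr
  obtain ⟨R, hR⟩ := hY.colorLE_range isometry_id (lt_of_lt_of_le one_pos (le_max_right L 1))
  rw [Set.range_id] at hR
  obtain ⟨c, b, hc, hb, hbR⟩ := hR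
  obtain ⟨D, hD⟩ := hL c b R
    (fun y y' h1 h2 => hb y trivial y' trivial h1 (h2.trans (le_max_left _ _)))
    (fun y y' => hbR y trivial y' trivial)
  exact ⟨D, hD.mono (fun x _ => Nat.le_of_lt_succ (hc (f x) trivial)) (by omega) le_rfl le_rfl⟩
end

section
/- Let X be a geodesic metric space, Y a metric space, and f : X → Y a Lipschitz map. Let n, k ∈ ℕ. Suppose that for every R > 0 the family {f⁻¹(B_R(y))}_{y ∈ Y} satisfies asdim ≤ n uniformly: for every r > 0 there is D > 0 such that for every y ∈ Y there exist r-disjoint families 𝒰⁰_y, …, 𝒰ⁿ_y of subsets of f⁻¹(B_R(y)), each member of diameter at most D, whose union covers f⁻¹(B_R(y)). If asdim Y ≤ k, then asdim X ≤ k + n. -/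
/-- A metric space is geodesic if every pair of points is joined by an isometrically embedded
segment. -/
def IsGeodesicSpace (X : Type*) [MetricSpace X] : Prop :=
  ∀ x y : X, ∃ γ : ℝ → X, γ 0 = x ∧ γ (dist x y) = y ∧
    ∀ s ∈ Set.Icc (0 : ℝ) (dist x y), ∀ t ∈ Set.Icc (0 : ℝ) (dist x y),
      dist (γ s) (γ t) = |s - t|

/-- One step of an `r`-chain inside `A`. -/
def ChainStep {X : Type*} [MetricSpace X] (r : ℝ) (A : Set X) (x y : X) : Prop :=
  x ∈ A ∧ y ∈ A ∧ dist x y ≤ r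

/-- Points joined by an `r`-chain inside `A` are at distance at most `D`. -/
def ChainBounded {X : Type*} [MetricSpace X] (r D : ℝ) (A : Set X) : Prop :=
  ∀ x y, Relation.ReflTransGen (ChainStep r A) x y → dist x y ≤ D

section Chains

open Relation

variable {X : Type*} [MetricSpace X]

theorem ChainStep.mono {r r' : ℝ} {A A' : Set X} (hr : r ≤ r') (hA : A ⊆ A') {x y : X}
    (h : ChainStep r A x y) : ChainStep r' A' x y :=
  ⟨hA h.1, hA h.2.1, h.2.2.trans hr⟩

theorem chain_symm {r : ℝ} {A : Set X} {x y : X} (h : ReflTransGen (ChainStep r A) x y) :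
    ReflTransGen (ChainStep r A) y x := by
  induction h with
  | refl => exact .refl
  | tail _ h ih => exact ih.head ⟨h.2.1, h.1, by rw [dist_comm]; exact h.2.2⟩

theorem mem_of_chain {r : ℝ} {A : Set X} {x y : X} (hx : x ∈ A)
    (h : ReflTransGen (ChainStep r A) x y) : y ∈ A := by
  induction h with
  | refl => exact hx
  | tail _ h _ => exact h.2.1

theorem ChainBounded.mono {r r' D D' : ℝ} {A A' : Set X} (h : ChainBounded r' D A')
    (hr : r ≤ r') (hD : D ≤ D') (hA : A ⊆ A') : ChainBounded r D' A :=
  fun x y hxy => (h x y (ReflTransGen.mono (fun _ _ => ChainStep.mono hr hA) _ _ hxy)).trans hD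

theorem chainBounded_empty {r D : ℝ} (hD : 0 ≤ D) : ChainBounded r D (∅ : Set X) := by
  intro x y h
  induction h with
  | refl => simpa using hD
  | tail _ h _ => exact h.1.elim

theorem RDisjoint.chainBounded_sUnion {r D : ℝ} {𝒰 : Set (Set X)} (h : RDisjoint r 𝒰)
    (hD : 0 ≤ D) (hdiam : ∀ U ∈ 𝒰, DiamLE D U) : ChainBounded r D (⋃₀ 𝒰) := by
  intro x y hxy
  have key : x = y ∨ ∃ U ∈ 𝒰, x ∈ U ∧ y ∈ U := by
    induction hxy with
    | refl => exact Or.inl rfl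
    | @tail y z _ hyz ih =>
      obtain ⟨⟨U, hU, hyU⟩, ⟨V, hV, hzV⟩, hd⟩ := hyz
      have hUV : U = V := by
        by_contra hne
        exact absurd (h U hU V hV hne y hyU z hzV) (not_lt.2 hd)
      subst hUV
      rcases ih with rfl | ⟨W, hW, hxW, hyW⟩
      · exact Or.inr ⟨U, hU, hyU, hzV⟩
      · have hUW : W = U := by
          by_contra hne
          have hlt := h W hW U hU hne y hyW y hyU
          rw [dist_self] at hlt
          exact absurd hlt (not_lt.2 (dist_nonneg.trans hd))
        subst hUW
        exact Or.inr ⟨W, hW, hxW, hzV⟩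
  rcases key with rfl | ⟨U, hU, hx, hy⟩
  · simpa using hD
  · exact hdiam U hU x hx y hy

/-- The `r`-chain components of `A`. -/
def chainComponents (r : ℝ) (A : Set X) : Set (Set X) :=
  {U | ∃ x ∈ A, U = {y | ReflTransGen (ChainStep r A) x y}}

theorem mem_chainComponents {r : ℝ} {A : Set X} {x : X} (hx : x ∈ A) :
    ∃ U ∈ chainComponents r A, x ∈ U :=
  ⟨_, ⟨x, hx, rfl⟩, ReflTransGen.refl⟩

theorem rDisjoint_chainComponents (r : ℝ) (A : Set X) : RDisjoint r (chainComponents r A) := by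
  rintro _ ⟨x, hx, rfl⟩ _ ⟨x', hx', rfl⟩ hne u hu v hv
  by_contra! hd
  have huv : ReflTransGen (ChainStep r A) u v :=
    ReflTransGen.single ⟨mem_of_chain hx hu, mem_of_chain hx' hv, hd⟩
  have hxx' : ReflTransGen (ChainStep r A) x x' :=
    (ReflTransGen.trans hu huv).trans (chain_symm hv)
  apply hne
  ext z
  exact ⟨fun hz => (chain_symm hxx').trans hz,
    fun hz => hxx'.trans hz⟩

theorem ChainBounded.diamLE_chainComponents {r D : ℝ} {A : Set X} (h : ChainBounded r D A) :
    ∀ U ∈ chainComponents r A, DiamLE D U := by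
  rintro _ ⟨x, _, rfl⟩ y hy z hz
  exact h y z ((chain_symm hy).trans hz)

theorem ChainBounded.union {r D D' : ℝ} {E F : Set X} (hr : 0 ≤ r) (hD : 0 ≤ D) (hD' : 0 ≤ D')
    (hE : ChainBounded r D E) (hF : ChainBounded (D + 2 * r) D' F) :
    ChainBounded r (D' + 2 * (D + r)) (E ∪ F) := by
  intro x y hxy
  have key : ReflTransGen (ChainStep r E) x y ∨
      ∃ a ∈ F, ∃ b ∈ F, dist x a ≤ D + r ∧ ReflTransGen (ChainStep (D + 2 * r) F) a b ∧
        ∃ e, dist b e ≤ r ∧ ReflTransGen (ChainStep r E) e y := by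
    induction hxy with
    | refl => exact Or.inl .refl
    | @tail y z _ hyz ih =>
      obtain ⟨hy, hz, hd⟩ := hyz
      rcases ih with hxy | ⟨a, ha, b, hb, hxa, hab, e, hbe, hey⟩
      · have hxyD := hE x y hxy
        rcases hz with hz | hz
        · rcases hy with hy | hy
          · exact Or.inl (hxy.tail ⟨hy, hz, hd⟩)
          · exact Or.inr ⟨y, hy, y, hy, by linarith, .refl, z, hd, .refl⟩
        · refine Or.inr ⟨z, hz, z, hz, ?_, .refl, z, by simpa using hr, .refl⟩
          linarith [dist_triangle x y z]
      · have heyD := hE e y hey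
        have hby := dist_triangle b e y
        rcases hz with hz | hz
        · rcases hy with hy | hy
          · exact Or.inr ⟨a, ha, b, hb, hxa, hab, e, hbe, hey.tail ⟨hy, hz, hd⟩⟩
          · exact Or.inr ⟨a, ha, y, hy, hxa, hab.tail ⟨hb, hy, by linarith⟩, z, hd, .refl⟩
        · refine Or.inr ⟨a, ha, z, hz, hxa, hab.tail ⟨hb, hz, ?_⟩, z, by simpa using hr, .refl⟩
          linarith [dist_triangle b y z]
  rcases key with h | ⟨a, _, b, _, hxa, hab, e, hbe, hey⟩
  · linarith [hE x y h]
  · linarith [hE e y hey, hF a b hab, dist_triangle x a y, dist_triangle a b y,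
      dist_triangle b e y]

/-- Chain bound of a union of `j` sets, the `i`-th of which is controlled by `D` at the scale
`unionBound r D i + 2 * r`. -/
def unionBound (r : ℝ) (D : ℝ → ℝ) : ℕ → ℝ
  | 0 => 0
  | j + 1 => D (unionBound r D j + 2 * r) + 2 * (unionBound r D j + r)

theorem unionBound_nonneg {r : ℝ} {D : ℝ → ℝ} (hr : 0 ≤ r) (hD : ∀ s, 0 ≤ D s) (j : ℕ) :
    0 ≤ unionBound r D j := by
  induction j with
  | zero => exact le_rfl
  | succ j ih =>
    have := hD (unionBound r D j + 2 * r)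
    simp only [unionBound]
    linarith

theorem chainBounded_biUnion {r : ℝ} {D : ℝ → ℝ} (hr : 0 ≤ r) (hD : ∀ s, 0 ≤ D s)
    (E : ℕ → Set X) (j : ℕ)
    (hE : ∀ i < j, ChainBounded (unionBound r D i + 2 * r) (D (unionBound r D i + 2 * r)) (E i)) :
    ChainBounded r (unionBound r D j) {x | ∃ i < j, x ∈ E i} := by
  induction j with
  | zero => exact (chainBounded_empty le_rfl).mono le_rfl le_rfl (by rintro x ⟨i, hi, _⟩; omega)
  | succ j ih =>
    refine ((ih fun i hi => hE i (by omega)).union hr (unionBound_nonneg hr hD j) (hD _)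
      (hE j (by omega))).mono le_rfl le_rfl ?_
    rintro x ⟨i, hi, hx⟩
    rcases Nat.lt_succ_iff_lt_or_eq.1 hi with h | rfl
    · exact Or.inl ⟨i, h, hx⟩
    · exact Or.inr hx

theorem ChainBounded.thicken {r D : ℝ} {U : Set X} (h : ChainBounded (3 * r) D U)
    (hr : 0 ≤ r) (hD : 0 ≤ D) : ChainBounded r (D + 2 * r) {x | ∃ u ∈ U, dist x u ≤ r} := by
  intro x y hxy
  have key : x = y ∨ ∃ u ∈ U, ∃ v ∈ U, dist x u ≤ r ∧ dist y v ≤ r ∧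
      ReflTransGen (ChainStep (3 * r) U) u v := by
    induction hxy with
    | refl => exact Or.inl rfl
    | @tail y z _ hyz ih =>
      obtain ⟨⟨v, hv, hyv⟩, ⟨w, hw, hzw⟩, hd⟩ := hyz
      have near : ∀ v', dist y v' ≤ r → dist v' w ≤ 3 * r := fun v' hv' => by
        linarith [dist_triangle v' y w, dist_triangle y z w, dist_comm v' y]
      rcases ih with rfl | ⟨u, hu, v', hv', hxu, hyv', huv⟩
      · exact Or.inr ⟨v, hv, w, hw, hyv, hzw, .single ⟨hv, hw, near v hyv⟩⟩
      · exact Or.inr ⟨u, hu, w, hw, hxu, hzw, huv.tail ⟨hv', hw, near v' hyv'⟩⟩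
  rcases key with rfl | ⟨u, _, v, _, hxu, hyv, huv⟩
  · rw [dist_self]; linarith
  · linarith [h u v huv, dist_triangle x u y, dist_triangle u v y, dist_comm v y]

/-- The points lying in all of exactly `p + 1` sets, and far from the other sets of the family,
form a chain bounded set. -/
theorem chainBounded_exact_inter {r D : ℝ} {N p : ℕ} {U : ℕ → Set X} (hr : 0 ≤ r) (hD : 0 ≤ D)
    (hU : ∀ i < N, ChainBounded (3 * r) D (U i)) :
    ChainBounded r D {x | ∃ S ⊆ Finset.range N, S.card = p + 1 ∧ (∀ s ∈ S, x ∈ U s) ∧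
      ∀ s < N, s ∉ S → ¬ ∃ u ∈ U s, dist x u ≤ r} := by
  intro x y hxy
  by_cases hxy_eq : x = y
  · simpa [hxy_eq] using hD
  obtain ⟨_, ⟨⟨S, hSN, hS, hxS, hxS'⟩, -⟩, -⟩ := hxy.cases_head.resolve_left hxy_eq
  clear hxy_eq
  obtain ⟨s₀, hs₀⟩ : S.Nonempty := Finset.card_pos.1 (by omega)
  have key : (∀ s ∈ S, y ∈ U s) ∧ (∀ s < N, s ∉ S → ¬ ∃ u ∈ U s, dist y u ≤ r) ∧
      ReflTransGen (ChainStep (3 * r) (U s₀)) x y := by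
    induction hxy with
    | refl => exact ⟨hxS, hxS', .refl⟩
    | @tail y z _ hyz ih =>
      obtain ⟨hyS, hyS', hxy⟩ := ih
      obtain ⟨_, ⟨S', hSN', hS', hzS, hzS'⟩, hd⟩ := hyz
      have hsub : S' ⊆ S := fun s hs => by
        by_contra hsS
        exact hyS' s (Finset.mem_range.1 (hSN' hs)) hsS ⟨z, hzS s hs, hd⟩
      obtain rfl : S' = S := Finset.eq_of_subset_of_card_le hsub (by omega)
      exact ⟨hzS, hzS', hxy.tail ⟨hyS s₀ hs₀, hzS s₀ hs₀, by linarith⟩⟩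
  exact hU s₀ (Finset.mem_range.1 (hSN hs₀)) x y key.2.2

open Classical in
/-- Kolmogorov's trick: a cover of `Z` by `n + 1` chain bounded sets can be replaced by
`n + 1 + p` chain bounded sets such that every point of `Z` lies in at least `p + 1` of them. -/
theorem exists_multiplicity_cover (n p : ℕ) {r D : ℝ} (hr : 0 ≤ r) (hD : 0 ≤ D) :
    ∃ D', 0 ≤ D' ∧ ∀ (Z : Set X) (U : ℕ → Set X),
      (∀ i < n + 1, ChainBounded (3 ^ p * r) D (U i)) → (∀ x ∈ Z, ∃ i < n + 1, x ∈ U i) →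
      ∃ V : ℕ → Set X, (∀ i < n + 1 + p, ChainBounded r D' (V i)) ∧
        ∀ x ∈ Z, p + 1 ≤ ((Finset.range (n + 1 + p)).filter fun i => x ∈ V i).card := by
  induction p generalizing r with
  | zero =>
    refine ⟨D, hD, fun Z U hU hZ => ⟨U, by simpa using hU, fun x hx => ?_⟩⟩
    obtain ⟨i, hi, hxi⟩ := hZ x hx
    exact Finset.card_pos.2 ⟨i, by simp [hxi]; omega⟩
  | succ p ih =>
    obtain ⟨D', hD', H⟩ := ih (r := 3 * r) (by linarith)
    refine ⟨D' + 2 * r, by linarith, fun Z U hU hZ => ?_⟩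
    obtain ⟨V, hV, hZV⟩ := H Z U (fun i hi => by rw [← mul_assoc, ← pow_succ]; exact hU i hi) hZ
    set N := n + 1 + p with hN
    let T : ℕ → Set X := fun i => {x | ∃ u ∈ V i, dist x u ≤ r}
    let M : Set X := {x | ∃ S ⊆ Finset.range N, S.card = p + 1 ∧ (∀ s ∈ S, x ∈ V s) ∧
      ∀ s < N, s ∉ S → ¬ ∃ u ∈ V s, dist x u ≤ r}
    let W : ℕ → Set X := fun i => if i < N then T i else M
    refine ⟨W, fun i hi => ?_, fun x hx => ?_⟩
    · by_cases h : i < N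
      · simpa only [W, if_pos h] using (hV i h).thicken hr hD'
      · simpa only [W, if_neg h] using
          (chainBounded_exact_inter hr hD' hV).mono le_rfl (by linarith) subset_rfl
    · have hVT : (Finset.range N).filter (fun i => x ∈ V i) ⊆
          (Finset.range N).filter (fun i => x ∈ T i) :=
        Finset.monotone_filter_right _ fun i _ hi => ⟨x, hi, by simpa using hr⟩
      have hTW : (Finset.range N).filter (fun i => x ∈ T i) ⊆
          (Finset.range (n + 1 + (p + 1))).filter (fun i => x ∈ W i) := by
        intro i hi
        simp only [Finset.mem_filter, Finset.mem_range] at hi ⊢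
        exact ⟨by omega, by simpa only [W, if_pos hi.1] using hi.2⟩
      have hVx := hZV x hx
      have hle := Finset.card_le_card hVT
      have hle' := Finset.card_le_card hTW
      by_cases hcard : p + 2 ≤ ((Finset.range N).filter fun i => x ∈ T i).card
      · omega
      have heq := Finset.eq_of_subset_of_card_le hVT (by omega)
      have hxM : x ∈ M := by
        refine ⟨(Finset.range N).filter fun i => x ∈ T i, Finset.filter_subset _ _, by omega, ?_, ?_⟩
        · intro s hs
          rw [← heq] at hs
          exact (Finset.mem_filter.1 hs).2
        · intro s hs hsT hxs
          exact hsT (Finset.mem_filter.2 ⟨Finset.mem_range.2 hs, hxs⟩)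
      have hlt := Finset.card_lt_card (Finset.ssubset_iff.2 ⟨N, by simp,
        Finset.insert_subset (Finset.mem_filter.2 ⟨Finset.mem_range.2 (by omega),
          by simpa only [W, if_neg (lt_irrefl N)] using hxM⟩) hTW⟩)
      omega

open Classical in
/-- Kolmogorov's trick for a cover of `Z` by disjoint uniformly bounded families. -/
theorem exists_multiplicity_cover_of_families (n p : ℕ) {r D : ℝ} (hr : 0 ≤ r) (hD : 0 ≤ D) :
    ∃ D', 0 ≤ D' ∧ ∀ (Z : Set X) (𝒰 : Fin (n + 1) → Set (Set X)),
      (∀ x ∈ Z, ∃ i, ∃ U ∈ 𝒰 i, x ∈ U) → (∀ i, RDisjoint (3 ^ p * r) (𝒰 i)) →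
      (∀ i, ∀ U ∈ 𝒰 i, DiamLE D U) →
      ∃ V : ℕ → Set X, (∀ i < n + 1 + p, ChainBounded r D' (V i)) ∧
        ∀ x ∈ Z, p + 1 ≤ ((Finset.range (n + 1 + p)).filter fun i => x ∈ V i).card := by
  obtain ⟨D', hD', H⟩ := exists_multiplicity_cover (X := X) n p hr hD
  refine ⟨D', hD', fun Z 𝒰 hcov hdisj hdiam => ?_⟩
  refine H Z (fun i => if h : i < n + 1 then ⋃₀ 𝒰 ⟨i, h⟩ else ∅) (fun i hi => ?_) fun x hx => ?_
  · simpa only [dif_pos hi] using (hdisj ⟨i, hi⟩).chainBounded_sUnion hD (hdiam ⟨i, hi⟩)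
  · obtain ⟨i, hi⟩ := hcov x hx
    exact ⟨i, i.2, by rw [dif_pos i.2]; exact hi⟩

end Chains

/-- Hurewicz-type theorem of Bell–Dranishnikov: if `f : X → Y` is a Lipschitz map from a
geodesic metric space, the preimages of `R`-balls satisfy `asdim ≤ n` uniformly, and
`asdim Y ≤ k`, then `asdim X ≤ k + n`. -/
theorem asdim_hurewicz_lipschitz {X Y : Type*} [MetricSpace X] [MetricSpace Y]
    (hgeo : IsGeodesicSpace X) (f : X → Y)
    (hlip : ∃ L : ℝ, ∀ x x' : X, dist (f x) (f x') ≤ L * dist x x')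
    (n k : ℕ)
    (hfib : ∀ R : ℝ, 0 < R → ∀ r : ℝ, 0 < r → ∃ D : ℝ, 0 < D ∧ ∀ y : Y,
      ∃ 𝒰 : Fin (n + 1) → Set (Set X),
        (∀ i, ∀ U ∈ 𝒰 i, U ⊆ f ⁻¹' Metric.closedBall y R) ∧
        (∀ x ∈ f ⁻¹' Metric.closedBall y R, ∃ i, ∃ U ∈ 𝒰 i, x ∈ U) ∧
        (∀ i, RDisjoint r (𝒰 i)) ∧
        (∀ i, ∀ U ∈ 𝒰 i, DiamLE D U))
    (hY : AsdimLE k Y) :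
    AsdimLE (k + n) X := by
  classical
  intro r hr
  obtain ⟨L, hL0, hL⟩ : ∃ L : ℝ, 0 < L ∧ ∀ x x' : X, dist (f x) (f x') ≤ L * dist x x' := by
    obtain ⟨L, hL⟩ := hlip
    exact ⟨max L 1, by positivity, fun x x' =>
      (hL x x').trans (mul_le_mul_of_nonneg_right (le_max_left _ _) dist_nonneg)⟩
  -- a cover `A` of `Y` by `k + 1 + n` sets of multiplicity `n + 1`
  obtain ⟨DA, hDA, A, hA, hAcard⟩ : ∃ DA, 0 ≤ DA ∧ ∃ A : ℕ → Set Y,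
      (∀ i < k + 1 + n, ChainBounded (L * r) DA (A i)) ∧
      ∀ y, n + 1 ≤ ((Finset.range (k + 1 + n)).filter fun i => y ∈ A i).card := by
    obtain ⟨𝒰, D, hcov, hdisj, hdiam⟩ := hY (3 ^ n * (L * r)) (by positivity)
    obtain ⟨D', hD', H⟩ := exists_multiplicity_cover_of_families (X := Y) k n
      (r := L * r) (by positivity) (le_max_right D 0)
    obtain ⟨A, hA, hAcard⟩ := H Set.univ 𝒰 (fun y _ => hcov y) hdisj
      fun i U hU x hx y hy => (hdiam i U hU x hx y hy).trans (le_max_left _ _)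
    exact ⟨D', hD', A, hA, fun y => hAcard y trivial⟩
  -- a cover `𝒱` of `Y` by `k + 1` families, disjoint at a scale larger than the components of `A`
  obtain ⟨𝒱, DV, h𝒱cov, h𝒱disj, h𝒱diam⟩ := hY (2 * DA + 1) (by positivity)
  -- covers of the preimages of bounded sets by `k + 1 + n` sets of multiplicity `k + 1`
  have hB : ∀ s : ℝ, ∃ D : ℝ, 0 ≤ D ∧ ∀ W : Set Y, ∃ B : ℕ → Set X,
      (∀ i < k + 1 + n, ChainBounded s D (B i)) ∧ (DiamLE DV W → ∀ x, f x ∈ W →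
        k + 1 ≤ ((Finset.range (k + 1 + n)).filter fun i => x ∈ B i).card) := by
    intro s
    have hs : 0 < max s 1 := by positivity
    obtain ⟨D, hD, hfam⟩ := hfib (max DV 1) (by positivity) (3 ^ k * max s 1) (by positivity)
    obtain ⟨D', hD', H⟩ := exists_multiplicity_cover_of_families (X := X) n k hs.le hD.le
    have hcomm : n + 1 + k = k + 1 + n := by omega
    rw [hcomm] at H
    refine ⟨D', hD', fun W => ?_⟩
    by_cases hW : W.Nonempty ∧ DiamLE DV W
    · obtain ⟨⟨y, hy⟩, hWD⟩ := hW
      obtain ⟨𝒰, _, hcov, hdisj, hdiam⟩ := hfam y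
      obtain ⟨B, hB, hBcard⟩ := H _ 𝒰 hcov hdisj hdiam
      exact ⟨B, fun i hi => (hB i hi).mono (le_max_left _ _) le_rfl subset_rfl,
        fun _ x hx => hBcard x ((hWD _ hx y hy).trans (le_max_left _ _))⟩
    · exact ⟨fun _ => ∅, fun _ _ => chainBounded_empty hD',
        fun hWD x hx => (hW ⟨⟨_, hx⟩, hWD⟩).elim⟩
  choose D hD B hB hBcard using hB
  let s : ℕ → ℝ := fun j => unionBound r D j + 2 * r
  let C : ℕ → Set X := fun i => {x | ∃ j : Fin (k + 1), ∃ W ∈ 𝒱 j,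
    f x ∈ W ∧ f x ∈ A i ∧ x ∈ B (s j) W i}
  have hC : ∀ i < k + 1 + n, ChainBounded r (unionBound r D (k + 1)) (C i) := by
    intro i hi x y hxy
    let E : ℕ → Set X := fun j => {z | ∃ hj : j < k + 1, ∃ W ∈ 𝒱 ⟨j, hj⟩,
      (∃ w ∈ W, dist (f x) w ≤ DA) ∧ z ∈ B (s j) W i}
    have hE : ∀ j < k + 1, ChainBounded (s j) (D (s j)) (E j) := by
      intro j hj
      by_cases hW : ∃ W ∈ 𝒱 ⟨j, hj⟩, ∃ w ∈ W, dist (f x) w ≤ DA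
      · obtain ⟨W, hW, w, hw, hxw⟩ := hW
        refine (hB (s j) W i hi).mono le_rfl le_rfl ?_
        rintro z ⟨_, W', hW', ⟨w', hw', hxw'⟩, hz⟩
        obtain rfl : W = W' := by
          by_contra hne
          have := h𝒱disj _ W hW W' hW' hne w hw w' hw'
          linarith [dist_triangle w (f x) w', dist_comm w (f x)]
        exact hz
      · refine (chainBounded_empty (hD (s j))).mono le_rfl le_rfl ?_
        rintro z ⟨_, W', hW', hw', _⟩
        exact hW ⟨W', hW', hw'⟩
    refine chainBounded_biUnion hr.le hD E (k + 1) hE x y ?_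
    have hCE : ∀ z ∈ C i, dist (f x) (f z) ≤ DA → ∃ j < k + 1, z ∈ E j := by
      rintro z ⟨j, W, hW, hzW, _, hzB⟩ hd
      exact ⟨j, j.2, j.2, W, hW, ⟨f z, hzW, hd⟩, hzB⟩
    have hnear : ∀ z, Relation.ReflTransGen (ChainStep r (C i)) x z →
        dist (f x) (f z) ≤ DA := by
      intro z hz
      refine hA i hi _ _ (Relation.ReflTransGen.lift f ?_ _ _ hz)
      rintro a b ⟨⟨_, _, _, _, ha, _⟩, ⟨_, _, _, _, hb, _⟩, hd⟩
      exact ⟨ha, hb, (hL a b).trans (mul_le_mul_of_nonneg_left hd hL0.le)⟩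
    induction hxy with
    | refl => exact .refl
    | @tail y z hxy hyz ih =>
      exact ih.tail ⟨hCE y hyz.1 (hnear y hxy), hCE z hyz.2.1 (hnear z (hxy.tail hyz)), hyz.2.2⟩
  refine ⟨fun i => chainComponents r (C i), unionBound r D (k + 1), fun x => ?_,
    fun i => rDisjoint_chainComponents r _,
    fun i => (hC i (by omega)).diamLE_chainComponents⟩
  obtain ⟨j, W, hW, hxW⟩ := h𝒱cov (f x)
  obtain ⟨i, hi⟩ : (((Finset.range (k + 1 + n)).filter fun i => f x ∈ A i) ∩
      ((Finset.range (k + 1 + n)).filter fun i => x ∈ B (s j) W i)).Nonempty := by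
    have hsum := Finset.card_union_add_card_inter
      ((Finset.range (k + 1 + n)).filter fun i => f x ∈ A i)
      ((Finset.range (k + 1 + n)).filter fun i => x ∈ B (s j) W i)
    have hunion := Finset.card_le_card (Finset.union_subset
      (Finset.filter_subset (fun i => f x ∈ A i) (Finset.range (k + 1 + n)))
      (Finset.filter_subset (fun i => x ∈ B (s j) W i) (Finset.range (k + 1 + n))))
    rw [Finset.card_range] at hunion
    have hAx := hAcard (f x)
    have hBx := hBcard (s j) W (h𝒱diam j W hW) x hxW
    exact Finset.card_pos.1 (by omega)
  simp only [Finset.mem_inter, Finset.mem_filter, Finset.mem_range] at hi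
  exact ⟨⟨i, by omega⟩, mem_chainComponents ⟨j, W, hW, hxW, hi.1.2, hi.2.2⟩⟩
end
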